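/- Let d be a permutation martingale and k ≥ 1. Let W_k = {g ∈ PPΠ : d(g) ≥ k and d(h) < k for all proper prefixes h of g}. Then W_k is prefix-free, S^k[d] = ∪_{g ∈ W_k} cyl(g) (in particular S^k[d] is μ-measurable), μ(S^k[d]) = Σ_{g ∈ W_k} μ(cyl(g)), and μ(S^k[d]) ≤ d([])/k. -/

import Mathlib

open Filter MeasureTheory

/-- Binary strings. -/
abbrev Str := List Bool

/-- The standard length-lexicographic enumeration `s_0 = λ, s_1 = 0, s_2 = 1, s_3 = 00, …`
of binary strings: `stdEnum n` is the binary representation of `n+1` with the leading 1 removed. -/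
def stdEnum (n : ℕ) : Str := ((n + 1).bits.dropLast).reverse

/-- The set Π of length-preserving permutations of `{0,1}*`. -/
structure LPPerm where
  toFun : Str → Str
  bij : Function.Bijective toFun
  lenPres : ∀ x, (toFun x).length = x.length

/-- `g` is a prefix partial permutation: a finite list of pairwise distinct binary strings
with `|g(s_i)| = |s_i|` for all `i < |g|`. -/
def IsPPP (g : List Str) : Prop :=
  g.Nodup ∧ ∀ i (h : i < g.length), (g.get ⟨i, h⟩).length = (stdEnum i).length

/-- The finite set of binary strings of length `n`. -/
def strsOfLen (n : ℕ) : Finset Str :=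
  (Finset.univ : Finset (Fin n → Bool)).image List.ofFn

/-- `free(g)`: strings of length `|s_{|g|}|` that do not occur as entries of `g`. -/
def freeSet (g : List Str) : Finset Str :=
  (strsOfLen (stdEnum g.length).length).filter (fun x => x ∉ g)

/-- A permutation martingale: nonnegative and satisfying the averaging condition
`d(g) = (1/|free(g)|) · Σ_{x ∈ free(g)} d((g,x))` on prefix partial permutations. -/
def IsPermMartingale (d : List Str → ℝ) : Prop :=
  (∀ g, 0 ≤ d g) ∧
    ∀ g, IsPPP g → d g = (1 / ((freeSet g).card : ℝ)) * ∑ x ∈ freeSet g, d (g ++ [x])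

/-- The cylinder measure `μ(g) = (∏_{k<n} 1/(2^k)!) · (2^n − m)!/(2^n)!` where
`2^n − 1 ≤ |g| < 2^{n+1} − 1` (so `n = log2(|g|+1)`) and `m = |g| − (2^n − 1)`. -/
noncomputable def muPPP (g : List Str) : ℝ :=
  (∏ k ∈ Finset.range (Nat.log2 (g.length + 1)), (1 : ℝ) / (Nat.factorial (2 ^ k))) *
      (Nat.factorial
        (2 ^ Nat.log2 (g.length + 1) - (g.length - (2 ^ Nat.log2 (g.length + 1) - 1)))) /
      (Nat.factorial (2 ^ Nat.log2 (g.length + 1)))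

/-- The cylinder of all permutations extending the prefix partial permutation `g`. -/
def cyl (g : List Str) : Set LPPerm :=
  {π | ∀ i (h : i < g.length), π.toFun (stdEnum i) = g.get ⟨i, h⟩}

/-- The σ-algebra `F_Π` generated by the cylinders. -/
instance : MeasurableSpace LPPerm :=
  MeasurableSpace.generateFrom {S | ∃ g, IsPPP g ∧ S = cyl g}

/-- `π↾N = [π(s_0), …, π(s_{N−1})]`. -/
def LPPerm.restrict (π : LPPerm) (N : ℕ) : List Str :=
  (List.range N).map (fun i => π.toFun (stdEnum i))

/-- `d` succeeds on `π`: `limsup_{N→∞} d(π↾N) = ∞`. -/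
def succeedsOn (d : List Str → ℝ) (π : LPPerm) : Prop :=
  ∀ C : ℝ, ∃ᶠ N in atTop, C < d (π.restrict N)

theorem foldr_bit_dropLast_bits (m : ℕ) (hm : m ≠ 0) :
    m.bits.dropLast.foldr Nat.bit 1 = m := by
  induction m using Nat.binaryRec' with
  | zero => exact absurd rfl hm
  | bit b n h ih =>
    rw [Nat.bits_append_bit n b h]
    rcases eq_or_ne n 0 with rfl | hn
    · simp [h rfl]
    · have hb : n.bits ≠ [] := fun h0 => by
        have := ih hn
        rw [h0] at this
        simp at this
        simp [← this] at h0
      rw [List.dropLast_cons_of_ne_nil hb, List.foldr_cons, ih hn]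

theorem stdEnum_injective : Function.Injective stdEnum := by
  intro a b h
  have h' : (a + 1).bits.dropLast = (b + 1).bits.dropLast := List.reverse_injective h
  have ha := foldr_bit_dropLast_bits (a + 1) (Nat.succ_ne_zero a)
  rw [h', foldr_bit_dropLast_bits (b + 1) (Nat.succ_ne_zero b)] at ha
  omega

theorem mem_strsOfLen {n : ℕ} {x : Str} : x ∈ strsOfLen n ↔ x.length = n := by
  simp only [strsOfLen, Finset.mem_image, Finset.mem_univ, true_and]
  constructor
  · rintro ⟨f, rfl⟩
    simp
  · rintro rfl
    exact ⟨x.get, List.ofFn_get x⟩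

theorem mem_freeSet {g : List Str} {x : Str} :
    x ∈ freeSet g ↔ x.length = (stdEnum g.length).length ∧ x ∉ g := by
  simp [freeSet, mem_strsOfLen]

theorem IsPPP.append_singleton {g : List Str} (hg : IsPPP g) {x : Str} (hx : x ∈ freeSet g) :
    IsPPP (g ++ [x]) := by
  rw [mem_freeSet] at hx
  refine ⟨hg.1.append (List.nodup_singleton x) (by simpa using hx.2), fun i h => ?_⟩
  rw [List.get_eq_getElem, List.getElem_append]
  split_ifs with hi
  · exact hg.2 i hi
  · have : i = g.length :=
      le_antisymm (Nat.lt_succ_iff.1 (by simpa using h)) (not_lt.1 hi)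
    simp [this, hx.1]

namespace LPPerm

variable (π : LPPerm)

@[simp]
theorem length_restrict (N : ℕ) : (π.restrict N).length = N := by simp [restrict]

theorem restrict_succ (N : ℕ) : π.restrict (N + 1) = π.restrict N ++ [π.toFun (stdEnum N)] := by
  simp [restrict, List.range_succ]

theorem isPPP_restrict (N : ℕ) : IsPPP (π.restrict N) :=
  ⟨List.nodup_range.map (π.bij.injective.comp stdEnum_injective),
    fun i h => by simp [restrict, π.lenPres]⟩

theorem apply_mem_freeSet_restrict (N : ℕ) : π.toFun (stdEnum N) ∈ freeSet (π.restrict N) := by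
  rw [mem_freeSet]
  refine ⟨by simp [π.lenPres], fun h => ?_⟩
  obtain ⟨i, hi, h⟩ := List.mem_map.1 h
  have := stdEnum_injective (π.bij.injective h)
  simp at hi
  omega

theorem take_restrict {M N : ℕ} (h : M ≤ N) : (π.restrict N).take M = π.restrict M := by
  simp [restrict, ← List.map_take, List.take_range, h]

theorem eq_restrict_of_prefix {h : List Str} {N : ℕ} (hp : h <+: π.restrict N) :
    h = π.restrict h.length := by
  have hl : h.length ≤ N := by simpa using hp.length_le
  rw [← π.take_restrict hl]
  exact List.prefix_iff_eq_take.1 hp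

theorem restrict_prefix {M N : ℕ} (h : M ≤ N) : π.restrict M <+: π.restrict N := by
  rw [← π.take_restrict h]
  exact List.take_prefix _ _

end LPPerm

theorem mem_cyl_iff {g : List Str} {π : LPPerm} : π ∈ cyl g ↔ π.restrict g.length = g := by
  constructor
  · intro h
    refine List.ext_getElem (by simp) fun i h₁ h₂ => ?_
    simpa [LPPerm.restrict] using h i h₂
  · intro h i hi
    have := List.getElem_of_eq h (by simpa using hi : i < (π.restrict g.length).length)
    simpa [LPPerm.restrict] using this

theorem measurableSet_cyl {g : List Str} (hg : IsPPP g) : MeasurableSet (cyl g) :=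
  MeasurableSpace.measurableSet_generateFrom ⟨g, hg, rfl⟩

theorem cyl_append_singleton_subset (g : List Str) (x : Str) : cyl (g ++ [x]) ⊆ cyl g := by
  intro π h
  rw [mem_cyl_iff] at h ⊢
  have hp : g <+: π.restrict (g ++ [x]).length := by
    rw [h]
    exact List.prefix_append _ _
  exact (π.eq_restrict_of_prefix hp).symm

theorem disjoint_cyl_append_singleton (g : List Str) {x y : Str} (h : x ≠ y) :
    Disjoint (cyl (g ++ [x])) (cyl (g ++ [y])) := by
  rw [Set.disjoint_left]
  intro π hx hy
  rw [mem_cyl_iff] at hx hy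
  rw [List.length_append, List.length_singleton] at hx hy
  exact h (by simpa using hx.symm.trans hy)

/-- A permutation martingale, weighted by cylinder measure, does not increase on average
when a prefix is extended by one value. -/
theorem IsPermMartingale.sum_mul_measure_cyl_le {d : List Str → ℝ} (hd : IsPermMartingale d)
    {μ : Measure LPPerm} (hμ : ∀ g, IsPPP g → μ (cyl g) = ENNReal.ofReal (muPPP g))
    {g : List Str} (hg : IsPPP g) :
    ∑ x ∈ freeSet g, ENNReal.ofReal (d (g ++ [x])) * μ (cyl (g ++ [x])) ≤
      ENNReal.ofReal (d g) * μ (cyl g) := by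
  rcases (freeSet g).eq_empty_or_nonempty with he | hne
  · simp [he]
  obtain ⟨c, hc⟩ : ∃ c, ∀ x ∈ freeSet g, μ (cyl (g ++ [x])) = c :=
    ⟨ENNReal.ofReal (muPPP (g ++ [[]])), fun x hx => by
      rw [hμ _ (hg.append_singleton hx)]
      simp [muPPP]⟩
  have hle : (freeSet g).card * c ≤ μ (cyl g) := by
    calc (freeSet g).card * c = ∑ x ∈ freeSet g, μ (cyl (g ++ [x])) := by
          rw [Finset.sum_congr rfl hc, Finset.sum_const, nsmul_eq_mul]
      _ = μ (⋃ x ∈ freeSet g, cyl (g ++ [x])) :=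
          (measure_biUnion_finset (fun x _ y _ h => disjoint_cyl_append_singleton g h)
            fun x hx => measurableSet_cyl (hg.append_singleton hx)).symm
      _ ≤ μ (cyl g) :=
          measure_mono (Set.iUnion₂_subset fun x _ => cyl_append_singleton_subset g x)
  have hcard : ((freeSet g).card : ℝ) ≠ 0 := by simpa using hne.ne_empty
  have hsum : ∑ x ∈ freeSet g, d (g ++ [x]) = d g * (freeSet g).card := by
    rw [hd.2 g hg]
    field_simp
  calc ∑ x ∈ freeSet g, ENNReal.ofReal (d (g ++ [x])) * μ (cyl (g ++ [x]))
      = ∑ x ∈ freeSet g, ENNReal.ofReal (d (g ++ [x])) * c :=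
        Finset.sum_congr rfl fun x hx => by rw [hc x hx]
    _ = ENNReal.ofReal (d g) * ((freeSet g).card * c) := by
        rw [← Finset.sum_mul, ← ENNReal.ofReal_sum_of_nonneg fun x _ => hd.1 _, hsum,
          ENNReal.ofReal_mul (hd.1 g), ENNReal.ofReal_natCast, mul_assoc]
    _ ≤ ENNReal.ofReal (d g) * μ (cyl g) := by gcongr

/-- Kolmogorov's inequality on a cylinder, over a bounded number of steps. -/
theorem IsPermMartingale.mul_measure_cyl_inter_le {d : List Str → ℝ} (hd : IsPermMartingale d)
    {μ : Measure LPPerm} (hμ : ∀ g, IsPPP g → μ (cyl g) = ENNReal.ofReal (muPPP g))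
    (c : ℝ) (n : ℕ) {g : List Str} (hg : IsPPP g) :
    ENNReal.ofReal c *
        μ (cyl g ∩ {π | ∃ M, g.length ≤ M ∧ M ≤ g.length + n ∧ c ≤ d (π.restrict M)}) ≤
      ENNReal.ofReal (d g) * μ (cyl g) := by
  induction n generalizing g with
  | zero =>
    rcases le_or_gt c (d g) with h | h
    · gcongr
      exact Set.inter_subset_left
    · have : cyl g ∩ {π | ∃ M, g.length ≤ M ∧ M ≤ g.length + 0 ∧ c ≤ d (π.restrict M)} = ∅ := by
        rw [Set.eq_empty_iff_forall_notMem]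
        rintro π ⟨hπ, M, h₁, h₂, h₃⟩
        rw [le_antisymm h₂ h₁, add_zero, mem_cyl_iff.1 hπ] at h₃
        exact absurd h₃ (not_le.2 h)
      rw [this, measure_empty, mul_zero]
      exact zero_le
  | succ n ih =>
    rcases le_or_gt c (d g) with h | h
    · gcongr
      exact Set.inter_subset_left
    · have hsub : cyl g ∩ {π | ∃ M, g.length ≤ M ∧ M ≤ g.length + (n + 1) ∧
            c ≤ d (π.restrict M)} ⊆
          ⋃ x ∈ freeSet g, cyl (g ++ [x]) ∩ {π | ∃ M, (g ++ [x]).length ≤ M ∧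
            M ≤ (g ++ [x]).length + n ∧ c ≤ d (π.restrict M)} := by
        rintro π ⟨hπ, M, h₁, h₂, h₃⟩
        rw [mem_cyl_iff] at hπ
        have hM : M ≠ g.length := by
          rintro rfl
          rw [hπ] at h₃
          exact absurd h₃ (not_le.2 h)
        refine Set.mem_iUnion₂.2 ⟨π.toFun (stdEnum g.length), ?_, ?_, M, ?_, ?_, h₃⟩
        · simpa [hπ] using π.apply_mem_freeSet_restrict g.length
        · rw [mem_cyl_iff, List.length_append, List.length_singleton, π.restrict_succ, hπ]
        all_goals rw [List.length_append, List.length_singleton]; omega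
      refine le_trans ?_ (hd.sum_mul_measure_cyl_le hμ hg)
      calc _ ≤ ENNReal.ofReal c * ∑ x ∈ freeSet g, μ (cyl (g ++ [x]) ∩
              {π | ∃ M, (g ++ [x]).length ≤ M ∧ M ≤ (g ++ [x]).length + n ∧
                c ≤ d (π.restrict M)}) := by
            gcongr
            exact (measure_mono hsub).trans (measure_biUnion_finset_le _ _)
        _ ≤ _ := by
            rw [Finset.mul_sum]
            exact Finset.sum_le_sum fun x hx => ih (hg.append_singleton hx)

/-- Kolmogorov's inequality for permutation martingales. -/
theorem IsPermMartingale.mul_measure_exists_le {d : List Str → ℝ} (hd : IsPermMartingale d)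
    {μ : Measure LPPerm} [IsProbabilityMeasure μ]
    (hμ : ∀ g, IsPPP g → μ (cyl g) = ENNReal.ofReal (muPPP g)) (c : ℝ) :
    ENNReal.ofReal c * μ {π | ∃ N, c ≤ d (π.restrict N)} ≤ ENNReal.ofReal (d []) := by
  have hU : {π : LPPerm | ∃ N, c ≤ d (π.restrict N)} =
      ⋃ n : ℕ, {π | ∃ M, M ≤ n ∧ c ≤ d (π.restrict M)} := by
    ext π
    simp only [Set.mem_ofPred_eq, Set.mem_iUnion]
    exact ⟨fun ⟨N, h⟩ => ⟨N, N, le_rfl, h⟩, fun ⟨_, M, _, h⟩ => ⟨M, h⟩⟩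
  have hmono : Monotone fun n : ℕ => {π : LPPerm | ∃ M, M ≤ n ∧ c ≤ d (π.restrict M)} :=
    fun _ _ hab _ ⟨M, hM, h⟩ => ⟨M, hM.trans hab, h⟩
  rw [hU, hmono.measure_iUnion, ENNReal.mul_iSup]
  refine iSup_le fun n => ?_
  have hnil : cyl [] = Set.univ := by
    ext π
    simp [cyl]
  simpa [hnil] using hd.mul_measure_cyl_inter_le hμ c n (g := []) ⟨List.nodup_nil, by simp⟩

/-- for a permutation martingale `d` and `k ≥ 1`, with
`W_k = {g ∈ PPΠ : d(g) ≥ k and d(h) < k for all proper prefixes h of g}`, the set `W_k` is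
prefix-free, `S^k[d] = ⋃_{g ∈ W_k} cyl(g)` (hence measurable),
`μ(S^k[d]) = Σ_{g ∈ W_k} μ(cyl(g))`, and `μ(S^k[d]) ≤ d([])/k`. -/
theorem stmt7 (μ : Measure LPPerm) (hprob : IsProbabilityMeasure μ)
    (hμ : ∀ g, IsPPP g → μ (cyl g) = ENNReal.ofReal (muPPP g))
    (d : List Str → ℝ) (hd : IsPermMartingale d) (k : ℕ) (hk : 1 ≤ k)
    (W : Set (List Str))
    (hW : W = {g | IsPPP g ∧ (k : ℝ) ≤ d g ∧ ∀ h, h <+: g → h ≠ g → d h < (k : ℝ)}) :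
    (∀ g ∈ W, ∀ h ∈ W, g <+: h → g = h) ∧
    {π : LPPerm | ∃ N, (k : ℝ) ≤ d (π.restrict N)} = (⋃ g ∈ W, cyl g) ∧
    MeasurableSet {π : LPPerm | ∃ N, (k : ℝ) ≤ d (π.restrict N)} ∧
    μ {π : LPPerm | ∃ N, (k : ℝ) ≤ d (π.restrict N)} = ∑' g : W, μ (cyl g) ∧
    μ {π : LPPerm | ∃ N, (k : ℝ) ≤ d (π.restrict N)} ≤ ENNReal.ofReal (d [] / k) := by
  have hpf : ∀ g ∈ W, ∀ h ∈ W, g <+: h → g = h := by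
    subst hW
    intro g hg h hh hgh
    by_contra hne
    exact absurd hg.2.1 (not_le.2 (hh.2.2 g hgh hne))
  have hU : {π : LPPerm | ∃ N, (k : ℝ) ≤ d (π.restrict N)} = ⋃ g ∈ W, cyl g := by
    subst hW
    ext π
    simp only [Set.mem_iUnion₂, exists_prop, Set.mem_ofPred_eq]
    constructor
    · classical
      intro hex
      refine ⟨π.restrict (Nat.find hex), ⟨π.isPPP_restrict _, Nat.find_spec hex, ?_⟩,
        by rw [mem_cyl_iff, π.length_restrict]⟩
      intro h hp hne
      have hlt : h.length < Nat.find hex :=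
        lt_of_le_of_ne (by simpa using hp.length_le)
          fun hl => hne (hp.eq_of_length (by simpa using hl))
      rw [π.eq_restrict_of_prefix hp]
      exact not_le.1 (Nat.find_min hex hlt)
    · rintro ⟨g, ⟨_, hg, _⟩, hπ⟩
      exact ⟨g.length, by rwa [mem_cyl_iff.1 hπ]⟩
  have hmeas : ∀ g ∈ W, MeasurableSet (cyl g) := by
    subst hW
    exact fun g hg => measurableSet_cyl hg.1
  have hdisj : W.PairwiseDisjoint cyl := by
    intro g hg h hh hne
    refine Set.disjoint_left.2 fun π h₁ h₂ => hne ?_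
    rw [mem_cyl_iff] at h₁ h₂
    rcases le_total g.length h.length with hl | hl
    · exact hpf g hg h hh (by simpa [h₁, h₂] using π.restrict_prefix hl)
    · exact (hpf h hh g hg (by simpa [h₁, h₂] using π.restrict_prefix hl)).symm
  refine ⟨hpf, hU, ?_, ?_, ?_⟩
  · rw [hU]
    exact MeasurableSet.biUnion W.to_countable hmeas
  · rw [hU]
    exact measure_biUnion W.to_countable hdisj hmeas
  · have hk0 : (0 : ℝ) < k := by exact_mod_cast hk
    rw [ENNReal.ofReal_div_of_pos hk0,
      ENNReal.le_div_iff_mul_le (Or.inl (by simpa using hk0.ne')) (Or.inl ENNReal.ofReal_ne_top), mul_comm]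
    exact hd.mul_measure_exists_le hμ k
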